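/- If A, B ∈ ℂ^{N×N} are positive definite Hermitian matrices, then their convolution A ⋄ B is positive definite. -/

import Mathlib

noncomputable def conv {M N : ℕ} (A B : Matrix (Fin M) (Fin N) ℂ) : Matrix (Fin M) (Fin N) ℂ :=
  fun i j => ∑ l ∈ Finset.Iic i, ∑ k ∈ Finset.Iic j, A l k * B (i - l) (j - k)

noncomputable def convId {M N : ℕ} : Matrix (Fin M) (Fin N) ℂ :=
  fun i j => if i.1 = 0 ∧ j.1 = 0 then 1 else 0

noncomputable def convPow {M N : ℕ} (A : Matrix (Fin M) (Fin N) ℂ) : ℕ → Matrix (Fin M) (Fin N) ℂ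
  | 0 => convId
  | k+1 => conv (convPow A k) A

noncomputable def convPoly {M N : ℕ} (p : Polynomial ℂ) (A : Matrix (Fin M) (Fin N) ℂ) :
    Matrix (Fin M) (Fin N) ℂ :=
  ∑ k ∈ p.support, p.coeff k • convPow A k

noncomputable def convP (N : ℕ) : Matrix (Fin N × Fin N) (Fin N) ℂ :=
  fun p i => if p.1 ≤ i ∧ p.2 = i - p.1 then 1 else 0

theorem conv_eq_convP (N : ℕ) (A B : Matrix (Fin N) (Fin N) ℂ) :
    conv A B = (convP N).conjTranspose * Matrix.kronecker A B * convP N := by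
  ext i j
  have h1 : ∀ (c d : Fin N), ((convP N).conjTranspose * Matrix.kronecker A B) i (c, d)
      = ∑ a ∈ Finset.Iic i, A a c * B (i - a) d := by
    intro c d
    rw [Matrix.mul_apply, Fintype.sum_prod_type, ← Finset.sum_subset (Finset.subset_univ (Finset.Iic i))]
    · refine Finset.sum_congr rfl fun a ha => ?_
      rw [Finset.mem_Iic] at ha
      simp [convP, ha, Matrix.conjTranspose_apply, apply_ite, ite_mul]
    · intro a _ ha
      rw [Finset.mem_Iic] at ha
      simp [convP, ha, Matrix.conjTranspose_apply]
  rw [Matrix.mul_apply, Fintype.sum_prod_type, conv, Finset.sum_comm,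
    ← Finset.sum_subset (Finset.subset_univ (Finset.Iic j))]
  · refine Finset.sum_congr rfl fun c hc => ?_
    rw [Finset.mem_Iic] at hc
    simp only [h1]
    simp [convP, hc]
  · intro c _ hc
    rw [Finset.mem_Iic] at hc
    simp [convP, hc]

theorem convP_inj (N : ℕ) : Function.Injective (convP N).mulVec := by
  intro x y h
  funext b
  haveI : NeZero N := ⟨by have := b.2; omega⟩
  have := congrFun h (0, b)
  simpa [convP, Matrix.mulVec, dotProduct] using this

open scoped ComplexOrder in
theorem conv_posDef (N : ℕ) (A B : Matrix (Fin N) (Fin N) ℂ)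
    (hA : A.PosDef) (hB : B.PosDef) : (conv A B).PosDef := by
  rw [conv_eq_convP]
  exact (hA.kronecker hB).conjTranspose_mul_mul_same (convP_inj N)
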